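/- Fix 1/2 < δ < 1. There exists M₀ ∈ ℕ such that for every integer M ≥ M₀, with A = { l ∈ {0,…,M−1} : |l − M/2| ≤ M^δ/2 }, g the discrete Gaussian, and f = g·𝟙_A, one has Z_A(f/‖f‖) ≥ exp(−340·e^{−(π/4)·M^{2δ−1}}), where ‖f‖² = Σ_{l∈ℤ}|f(l)|² (note Z_A(f/‖f‖) = Z_A(f)/‖f‖²). -/

import Mathlib

open scoped Classical

noncomputable section

/-- `e^{-2πi x}` -/
def ec (x : ℝ) : ℂ := Complex.exp (-(2 * Real.pi * x) * Complex.I)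

/-- The 1-periodic function `G_f(x) = M^{-1/2} Σ_{l ∈ ℤ} f(l) e^{-2πi l x}`. -/
def Gf (M : ℕ) (f : ℤ → ℂ) (x : ℝ) : ℂ :=
  ((Real.sqrt M)⁻¹ : ℝ) * ∑' l : ℤ, f l * ec ((l : ℝ) * x)

/-- The alphabet `A = { l ∈ {0,…,M-1} : |l - M/2| ≤ M^δ/2 }`. -/
def alphabetA (M : ℕ) (δ : ℝ) : Finset ℕ :=
  (Finset.range M).filter fun l => |(l : ℝ) - (M : ℝ) / 2| ≤ (M : ℝ) ^ δ / 2

/-- The discrete Gaussian `g(l) = M^{-1/2} e^{-π(l-M/2)²/M} e^{iπl}`. -/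
def gaussD (M : ℕ) : ℤ → ℂ := fun l =>
  (((Real.sqrt M)⁻¹ * Real.exp (-(Real.pi * ((l : ℝ) - (M : ℝ) / 2) ^ 2 / (M : ℝ))) : ℝ) : ℂ) *
    Complex.exp ((Real.pi * (l : ℝ) : ℝ) * Complex.I)

/-- The restriction `f·𝟙_A` of `f : ℤ → ℂ` to an alphabet `A ⊆ ℕ`, extended by zero. -/
def restrictA (A : Finset ℕ) (f : ℤ → ℂ) : ℤ → ℂ := fun l =>
  if ∃ a ∈ A, l = (a : ℤ) then f l else 0

/-- `Z_A(f) = min_{y ∈ [0,1/M]} Σ_{a ∈ A} |G_f(a/M + y)|²`. -/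
def ZA (M : ℕ) (A : Finset ℕ) (f : ℤ → ℂ) : ℝ :=
  sInf ((fun y => ∑ a ∈ A, ‖Gf M f ((a : ℝ) / (M : ℝ) + y)‖ ^ 2) ''
    Set.Icc 0 (1 / (M : ℝ)))

theorem ec_norm (x : ℝ) : ‖ec x‖ = 1 := by
  have : ec x = Complex.exp (((-(2 * Real.pi * x) : ℝ) : ℂ) * Complex.I) := by
    unfold ec; push_cast; rfl
  rw [this, Complex.norm_exp_ofReal_mul_I]

theorem ec_add (x y : ℝ) : ec (x + y) = ec x * ec y := by
  unfold ec; rw [← Complex.exp_add]; congr 1; push_cast; ring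

theorem ec_conj (x : ℝ) : (starRingEnd ℂ) (ec x) = ec (-x) := by
  unfold ec; rw [← Complex.exp_conj]; congr 1; simp; left; exact map_ofNat _ 2

theorem ec_sum (M : ℕ) (hM : 1 ≤ M) (l k : ℕ) (hl : l < M) (hk : k < M) :
    ∑ a ∈ Finset.range M, ec (((l : ℝ) - k) * ((a : ℝ) / M)) = if l = k then (M : ℂ) else 0 := by
  have hM0 : (M : ℂ) ≠ 0 := by exact_mod_cast (by omega : M ≠ 0)
  split_ifs with h
  · subst h; simp [ec]
  · set z : ℂ := ec (((l : ℝ) - k) / M) with hz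
    have hpow : ∀ a : ℕ, ec (((l : ℝ) - k) * ((a : ℝ) / M)) = z ^ a := by
      intro a
      rw [hz]; unfold ec; rw [← Complex.exp_nat_mul]; congr 1; push_cast; ring
    simp_rw [hpow]
    have hz1 : z ≠ 1 := by
      intro h1
      rw [hz] at h1; unfold ec at h1
      rw [Complex.exp_eq_one_iff] at h1
      obtain ⟨n, hn⟩ := h1
      have h2 : ((k : ℂ) - l) = n * M := by
        have hp : (2 * (Real.pi : ℂ) * Complex.I) ≠ 0 := Complex.two_pi_I_ne_zero
        push_cast at hn
        field_simp at hn
        linear_combination hn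
      have h3 : ((k : ℤ) - l) = n * M := by exact_mod_cast h2
      have : n = 0 := by
        by_contra hn0
        rcases lt_or_gt_of_ne hn0 with h | h <;> nlinarith
      subst this
      apply h; omega
    have hzM : z ^ M = 1 := by
      rw [hz]; unfold ec; rw [← Complex.exp_nat_mul, Complex.exp_eq_one_iff]
      refine ⟨(k : ℤ) - l, ?_⟩
      push_cast; field_simp; ring
    have := mul_neg_geom_sum z M
    rw [hzM, sub_self] at this
    rcases mul_eq_zero.1 this with h | h
    · exact absurd (sub_eq_zero.1 h).symm hz1
    · exact h

theorem parseval (M : ℕ) (hM : 1 ≤ M) (f : ℕ → ℂ) (y : ℝ) :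
    ∑ a ∈ Finset.range M, ‖∑ l ∈ Finset.range M, f l * ec ((l : ℝ) * ((a : ℝ) / M + y))‖ ^ 2
      = M * ∑ l ∈ Finset.range M, ‖f l‖ ^ 2 := by
  have key : ∀ a : ℕ, (((‖∑ l ∈ Finset.range M, f l * ec ((l : ℝ) * ((a : ℝ) / M + y))‖ ^ 2 : ℝ)) : ℂ)
      = ∑ l ∈ Finset.range M, ∑ k ∈ Finset.range M,
        (f l * (starRingEnd ℂ) (f k) * ec (((l : ℝ) - k) * y)) * ec (((l : ℝ) - k) * ((a : ℝ) / M)) := by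
    intro a
    push_cast
    rw [← Complex.mul_conj', map_sum, Finset.sum_mul_sum]
    refine Finset.sum_congr rfl fun l _ => Finset.sum_congr rfl fun k _ => ?_
    rw [map_mul, ec_conj, mul_assoc _ (ec _) (ec _), ← ec_add, mul_mul_mul_comm, ← ec_add]
    congr 2; ring
  have : (((∑ a ∈ Finset.range M, ‖∑ l ∈ Finset.range M, f l * ec ((l : ℝ) * ((a : ℝ) / M + y))‖ ^ 2 : ℝ)) : ℂ)
      = ((M * ∑ l ∈ Finset.range M, ‖f l‖ ^ 2 : ℝ) : ℂ) := by
    rw [Complex.ofReal_sum]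
    simp_rw [key]
    rw [Finset.sum_comm]
    push_cast
    rw [Finset.mul_sum]
    refine Finset.sum_congr rfl fun l hl => ?_
    rw [Finset.sum_comm]
    have : ∀ k ∈ Finset.range M, ∑ a ∈ Finset.range M,
        (f l * (starRingEnd ℂ) (f k) * ec (((l : ℝ) - k) * y)) * ec (((l : ℝ) - k) * ((a : ℝ) / M))
        = if l = k then (M : ℂ) * (‖f l‖ : ℂ) ^ 2 else 0 := by
      intro k hk
      rw [← Finset.mul_sum, ec_sum M hM l k (Finset.mem_range.1 hl) (Finset.mem_range.1 hk)]
      split_ifs with h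
      · subst h; rw [Complex.mul_conj']; simp [ec]; ring
      · simp
    rw [Finset.sum_congr rfl this]
    rw [Finset.sum_ite_eq, if_pos hl]
  exact_mod_cast this

theorem summ1 : Summable fun j : ℤ => 1 / (1 + (j : ℝ) ^ 2) := by
  have h := (Real.summable_one_div_int_pow (p := 2)).2 (by norm_num)
  refine Summable.of_norm_bounded_eventually h ?_
  have : ({0} : Set ℤ)ᶜ ∈ Filter.cofinite := (Set.finite_singleton 0).compl_mem_cofinite
  filter_upwards [this] with j hj
  have hj : (j : ℝ) ≠ 0 := by exact_mod_cast hj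
  rw [Real.norm_of_nonneg (by positivity)]
  have : 0 < (j : ℝ) ^ 2 := by positivity
  gcongr; linarith

theorem summ2 : Summable fun j : ℤ => Real.exp (-Real.pi * ((j : ℝ) ^ 2 - |(j : ℝ)|)) := by
  refine Summable.of_nonneg_of_le (fun _ => (Real.exp_pos _).le) ?_ (summ1.mul_left 10)
  intro j
  have h1 : (0 : ℝ) ≤ (j : ℝ) ^ 2 - |(j : ℝ)| := by
    rw [← sq_abs, ← Int.cast_abs]
    have : (0 : ℤ) ≤ |j| ^ 2 - |j| := by
      have : 0 ≤ |j| := abs_nonneg j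
      rcases eq_or_lt_of_le this with h | h
      · rw [← h]; norm_num
      · nlinarith
    exact_mod_cast this
  set z := (j : ℝ) ^ 2 - |(j : ℝ)| with hz
  have h2 : (j : ℝ) ^ 2 ≤ 2 * z + 2 := by
    rw [hz, ← sq_abs]; nlinarith [sq_nonneg (|(j : ℝ)| - 1)]
  have h3 := Real.add_one_le_exp (Real.pi * z)
  have h4 := Real.pi_gt_three
  rw [neg_mul, Real.exp_neg, mul_one_div, ← one_div, div_le_div_iff₀ (Real.exp_pos _) (by positivity)]
  nlinarith

theorem theta_bound (M : ℕ) (hM : 1 ≤ M) (x : ℝ) (hx0 : 0 ≤ x) (hx1 : x ≤ 1) :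
    ‖∑' l : ℤ, gaussD M l * ec ((l : ℝ) * x)‖ ≤
      (∑' j : ℤ, Real.exp (-Real.pi * ((j : ℝ) ^ 2 - |(j : ℝ)|))) *
        Real.exp (-Real.pi * (M * (x - 1 / 2) ^ 2)) := by
  have hMr : (1 : ℝ) ≤ M := by exact_mod_cast hM
  have hM0 : (M : ℂ) ≠ 0 := by exact_mod_cast (by omega : M ≠ 0)
  have hs : (0 : ℝ) < Real.sqrt M := Real.sqrt_pos.2 (by linarith)
  have ha : 0 < ((1 / M : ℝ) : ℂ).re := by
    rw [Complex.ofReal_re]; positivity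
  have hP := Complex.tsum_exp_neg_quadratic ha (1 / 2 + Complex.I * (1 / 2 - x))
  have hL : ∀ l : ℤ, gaussD M l * ec ((l : ℝ) * x) =
      ((Real.sqrt M)⁻¹ * Real.exp (-(Real.pi * M / 4)) : ℝ) *
      Complex.exp (-Real.pi * ((1 / M : ℝ) : ℂ) * l ^ 2 + 2 * Real.pi * (1 / 2 + Complex.I * (1 / 2 - x)) * l) := by
    intro l
    unfold gaussD ec
    push_cast
    rw [mul_assoc, mul_assoc, mul_assoc, ← Complex.exp_add, ← Complex.exp_add, mul_assoc (((Real.sqrt M : ℝ) : ℂ)⁻¹), ← Complex.exp_add]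
    congr 2
    field_simp
    ring
  simp_rw [hL]
  rw [tsum_mul_left, hP]
  have hR : ∀ n : ℤ, ‖Complex.exp (-Real.pi / ((1 / M : ℝ) : ℂ) * (n + Complex.I * (1 / 2 + Complex.I * (1 / 2 - x))) ^ 2)‖
      = Real.exp (Real.pi * M / 4) * Real.exp (-Real.pi * (M * (n + (x - 1 / 2)) ^ 2)) := by
    intro n
    rw [Complex.norm_exp, ← Real.exp_add]
    congr 1
    have : (-Real.pi / ((1 / M : ℝ) : ℂ) * (n + Complex.I * (1 / 2 + Complex.I * (1 / 2 - x))) ^ 2)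
       = ((Real.pi * M / 4 + -Real.pi * (M * (n + (x - 1 / 2)) ^ 2) : ℝ) : ℂ) +
         ((-Real.pi * M * (n + (x - 1 / 2)) : ℝ) : ℂ) * Complex.I := by
      have hI : Complex.I ^ 2 = -1 := Complex.I_sq
      push_cast
      have e : ((n : ℂ) + Complex.I * (1 / 2 + Complex.I * (1 / 2 - x))) = (n + (x - 1 / 2)) + Complex.I / 2 := by
        linear_combination (1 / 2 - (x : ℂ)) * hI
      rw [e, one_div, div_inv_eq_mul]
      linear_combination (-(Real.pi : ℂ) * M / 4) * hI
    rw [this, Complex.add_re, Complex.ofReal_re, Complex.re_ofReal_mul, Complex.I_re, mul_zero, add_zero]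
  have hb : ∀ n : ℤ, ‖Complex.exp (-Real.pi / ((1 / M : ℝ) : ℂ) * (n + Complex.I * (1 / 2 + Complex.I * (1 / 2 - x))) ^ 2)‖ ≤ Real.exp (Real.pi * M / 4) * Real.exp (-Real.pi * (M * (x - 1 / 2) ^ 2)) * Real.exp (-Real.pi * ((n : ℝ) ^ 2 - |(n : ℝ)|)) := by
    intro n
    rw [hR, mul_assoc, ← Real.exp_add (-Real.pi * _)]
    gcongr
    have h1 : (0 : ℝ) ≤ (n : ℝ) ^ 2 - |(n : ℝ)| := by
      rw [← sq_abs, ← Int.cast_abs]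
      have : (0 : ℤ) ≤ |n| ^ 2 - |n| := by
        have : 0 ≤ |n| := abs_nonneg n
        rcases eq_or_lt_of_le this with h | h
        · rw [← h]; norm_num
        · nlinarith
      exact_mod_cast this
    have h2 : -|(n : ℝ)| ≤ 2 * n * (x - 1 / 2) := by
      rcases abs_cases (n : ℝ) with ⟨h, h'⟩ | ⟨h, h'⟩ <;> rw [h] <;> nlinarith
    have h3 : (n : ℝ) ^ 2 - |(n : ℝ)| ≤ M * ((n + (x - 1 / 2)) ^ 2 - (x - 1 / 2) ^ 2) := by
      have : (n : ℝ) ^ 2 - |(n : ℝ)| ≤ ((n + (x - 1 / 2)) ^ 2 - (x - 1 / 2) ^ 2) := by nlinarith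
      nlinarith
    nlinarith [Real.pi_pos]
  have hn := tsum_of_norm_bounded (summ2.mul_left (Real.exp (Real.pi * M / 4) * Real.exp (-Real.pi * (M * (x - 1 / 2) ^ 2)))).hasSum hb
  rw [tsum_mul_left] at hn
  have hsq : ‖(1 / ((1 / M : ℝ) : ℂ) ^ (1 / 2 : ℂ))‖ = Real.sqrt M := by
    rw [norm_div, norm_one, Complex.norm_cpow_eq_rpow_re_of_pos (by positivity)]
    simp only [one_div]
    rw [Real.sqrt_eq_rpow]
    norm_num
    rw [Real.inv_rpow (by positivity), inv_inv]
  rw [norm_mul, norm_mul, hsq, Complex.norm_real, Real.norm_of_nonneg (by positivity)]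
  have hexp : Real.exp (-(Real.pi * M / 4)) * Real.exp (Real.pi * M / 4) = 1 := by
    rw [← Real.exp_add]; simp
  set T := ∑' j : ℤ, Real.exp (-Real.pi * ((j : ℝ) ^ 2 - |(j : ℝ)|))
  calc _ ≤ (Real.sqrt M)⁻¹ * Real.exp (-(Real.pi * M / 4)) * (Real.sqrt M * (Real.exp (Real.pi * M / 4) * Real.exp (-Real.pi * (M * (x - 1 / 2) ^ 2)) * T)) := by gcongr
    _ = ((Real.sqrt M)⁻¹ * Real.sqrt M) * (Real.exp (-(Real.pi * M / 4)) * Real.exp (Real.pi * M / 4)) * (T * Real.exp (-Real.pi * (M * (x - 1 / 2) ^ 2))) := by ring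
    _ = _ := by rw [hexp, inv_mul_cancel₀ hs.ne']; ring

theorem gauss_norm (M : ℕ) (l : ℤ) : ‖gaussD M l‖ =
    (Real.sqrt M)⁻¹ * Real.exp (-(Real.pi * ((l : ℝ) - (M : ℝ) / 2) ^ 2 / (M : ℝ))) := by
  unfold gaussD
  rw [norm_mul, Complex.norm_exp_ofReal_mul_I, mul_one, Complex.norm_real,
    Real.norm_of_nonneg (by positivity)]

theorem gauss_bound (M : ℕ) (hM : 1 ≤ M) (l : ℤ) : ‖gaussD M l‖ ≤
    16 * M * (1 / (1 + ((l - (M / 2 : ℕ) : ℤ) : ℝ) ^ 2)) *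
      Real.exp (-(3 / 4 * Real.pi * (((l : ℝ) - (M : ℝ) / 2) ^ 2 / (M : ℝ)))) := by
  have hMr : (1 : ℝ) ≤ M := by exact_mod_cast hM
  rw [gauss_norm]
  set t := (l : ℝ) - (M : ℝ) / 2 with ht
  set j : ℤ := l - (M / 2 : ℕ) with hj
  have hjt : (j : ℝ) ^ 2 ≤ 4 * t ^ 2 := by
    rcases Nat.even_or_odd' M with ⟨m, h | h⟩
    · have h1 : M / 2 = m := by omega
      have : t = j := by rw [ht, hj, h1, h]; push_cast; ring
      rw [this]; nlinarith [sq_nonneg (j : ℝ)]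
    · have h1 : M / 2 = m := by omega
      have : t = j - 1 / 2 := by rw [ht, hj, h1, h]; push_cast; ring
      rw [this]
      have h0 : (0 : ℤ) ≤ (3 * j - 1) * (j - 1) := by
        rcases le_or_gt j 0 with h | h
        · nlinarith
        · apply mul_nonneg <;> omega
      have h0 : (0 : ℝ) ≤ (3 * j - 1) * (j - 1) := by exact_mod_cast h0
      nlinarith
  have hs : (Real.sqrt M)⁻¹ ≤ 1 := inv_le_one_of_one_le₀ (by rwa [Real.one_le_sqrt])
  have he : Real.exp (-(Real.pi * t ^ 2 / M)) =
      Real.exp (-(1 / 4 * Real.pi * (t ^ 2 / M))) * Real.exp (-(3 / 4 * Real.pi * (t ^ 2 / M))) := by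
    rw [← Real.exp_add]; congr 1; ring
  rw [he, ← mul_assoc]
  refine mul_le_mul_of_nonneg_right ?_ (Real.exp_pos _).le
  have h2 : Real.exp (-(1 / 4 * Real.pi * (t ^ 2 / M))) ≤ 16 * M * (1 / (1 + (j : ℝ) ^ 2)) := by
    have h3 := Real.add_one_le_exp (1 / 4 * Real.pi * (t ^ 2 / M))
    have h4 := Real.pi_gt_three
    rw [Real.exp_neg, mul_one_div, ← one_div, div_le_div_iff₀ (Real.exp_pos _) (by positivity)]
    set z := t ^ 2 / M with hz
    have hz0 : 0 ≤ z := by positivity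
    have htz : t ^ 2 = M * z := by rw [hz]; field_simp
    have h5 : 1 / 4 * 3 * z + 1 ≤ Real.exp (1 / 4 * Real.pi * z) := by
      nlinarith
    have h6 : M * (1 / 4 * 3 * z + 1) ≤ M * Real.exp (1 / 4 * Real.pi * z) := by gcongr
    have h7 : 0 ≤ M * z := by positivity
    nlinarith
  calc _ ≤ 1 * Real.exp (-(1 / 4 * Real.pi * (t ^ 2 / M))) := by gcongr
    _ ≤ _ := by rw [one_mul]; exact h2

theorem summ3 (m : ℤ) : Summable (fun l : ℤ => 1 / (1 + ((l - m : ℤ) : ℝ) ^ 2)) ∧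
    ∑' l : ℤ, 1 / (1 + ((l - m : ℤ) : ℝ) ^ 2) = ∑' l : ℤ, 1 / (1 + (l : ℝ) ^ 2) :=
  ⟨((Equiv.subRight m).summable_iff (f := fun l : ℤ => 1 / (1 + (l : ℝ) ^ 2))).2 summ1,
   (Equiv.subRight m).tsum_eq (fun l : ℤ => 1 / (1 + (l : ℝ) ^ 2))⟩

theorem summ_gauss (M : ℕ) (hM : 1 ≤ M) (x : ℝ) : Summable fun l : ℤ => gaussD M l * ec ((l : ℝ) * x) := by
  refine Summable.of_norm_bounded ((summ3 (M / 2 : ℕ)).1.mul_left (16 * (M : ℝ))) ?_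
  intro l
  rw [norm_mul, ec_norm, mul_one]
  refine (gauss_bound M hM l).trans ?_
  refine mul_le_of_le_one_right (by positivity) ?_
  rw [Real.exp_le_one_iff, neg_nonpos]
  have := Real.pi_pos
  positivity

theorem rpow_id (M : ℕ) (hM : 1 ≤ M) (δ : ℝ) : (M : ℝ) ^ (2 * δ - 1) = ((M : ℝ) ^ δ) ^ 2 / M := by
  have hMr : (0 : ℝ) < M := by exact_mod_cast hM
  rw [Real.rpow_sub hMr, Real.rpow_one, mul_comm, Real.rpow_mul hMr.le]
  norm_num

theorem not_mem (M : ℕ) (hM : 1 ≤ M) (δ : ℝ) (hδ2 : δ < 1) (l : ℤ)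
    (hl : ¬ ∃ a ∈ alphabetA M δ, l = (a : ℤ)) : (M : ℝ) ^ δ / 2 ≤ |(l : ℝ) - (M : ℝ) / 2| := by
  have hMr : (1 : ℝ) ≤ M := by exact_mod_cast hM
  have hle : (M : ℝ) ^ δ ≤ M := by
    conv_rhs => rw [← Real.rpow_one (M : ℝ)]
    exact Real.rpow_le_rpow_of_exponent_le hMr hδ2.le
  by_contra hc
  push Not at hc
  have h1 := abs_lt.1 hc
  have h0 : (0 : ℝ) < l := by linarith
  have h2 : (l : ℝ) < M := by linarith
  have h0' : 0 < l := by exact_mod_cast h0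
  have h2' : l < M := by exact_mod_cast h2
  obtain ⟨n, rfl⟩ := Int.eq_ofNat_of_zero_le h0'.le
  refine hl ⟨n, ?_, rfl⟩
  unfold alphabetA
  rw [Finset.mem_filter, Finset.mem_range]
  refine ⟨by exact_mod_cast h2', ?_⟩
  push_cast at hc
  exact hc.le

theorem tail_bound (M : ℕ) (hM : 1 ≤ M) (δ : ℝ) (hδ2 : δ < 1) (x : ℝ) :
    ‖∑' l : ℤ, (gaussD M l * ec ((l : ℝ) * x) - restrictA (alphabetA M δ) (gaussD M) l * ec ((l : ℝ) * x))‖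
      ≤ 16 * M * (∑' l : ℤ, 1 / (1 + (l : ℝ) ^ 2)) *
        Real.exp (-(3 / 16 * Real.pi * (M : ℝ) ^ (2 * δ - 1))) := by
  have hMr : (1 : ℝ) ≤ M := by exact_mod_cast hM
  have hs := (summ3 (M / 2 : ℕ)).1.mul_left (16 * (M : ℝ) * Real.exp (-(3 / 16 * Real.pi * (M : ℝ) ^ (2 * δ - 1))))
  have := tsum_of_norm_bounded hs.hasSum (f := fun l : ℤ => (gaussD M l * ec ((l : ℝ) * x) - restrictA (alphabetA M δ) (gaussD M) l * ec ((l : ℝ) * x))) ?_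
  · rw [tsum_mul_left, (summ3 _).2] at this
    linarith
  · intro l
    unfold restrictA
    split_ifs with h
    · rw [sub_self, norm_zero]; positivity
    · rw [zero_mul, sub_zero, norm_mul, ec_norm, mul_one]
      refine (gauss_bound M hM l).trans ?_
      rw [mul_right_comm]
      refine mul_le_mul_of_nonneg_right (mul_le_mul_of_nonneg_left (Real.exp_le_exp.2 ?_) (by positivity)) (by positivity)
      have h1 := not_mem M hM δ hδ2 l h
      have h2 : ((M : ℝ) ^ δ / 2) ^ 2 ≤ ((l : ℝ) - (M : ℝ) / 2) ^ 2 := by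
        rw [← sq_abs ((l : ℝ) - _)]; gcongr
      rw [rpow_id M hM δ]
      have h3 : ((M : ℝ) ^ δ / 2) ^ 2 / M ≤ ((l : ℝ) - (M : ℝ) / 2) ^ 2 / M := by gcongr
      have h4 : ((M : ℝ) ^ δ / 2) ^ 2 / M = ((M : ℝ) ^ δ) ^ 2 / M / 4 := by ring
      rw [h4] at h3
      nlinarith [Real.pi_pos]

theorem restrict_tsum {E : Type*} [AddCommMonoid E] [TopologicalSpace E] (M : ℕ) (δ : ℝ) (g : ℤ → ℂ) (F : ℤ → ℂ → E) (hF : ∀ l, F l 0 = 0) :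
    ∑' l : ℤ, F l (restrictA (alphabetA M δ) g l) =
      ∑ l ∈ Finset.range M, F l (restrictA (alphabetA M δ) g l) := by
  rw [tsum_eq_sum (s := (Finset.range M).map Nat.castEmbedding)]
  · rw [Finset.sum_map]; rfl
  · intro l hl
    unfold restrictA
    rw [if_neg, hF]
    rintro ⟨a, ha, rfl⟩
    apply hl
    unfold alphabetA at ha
    rw [Finset.mem_map]
    exact ⟨a, (Finset.mem_filter.1 ha).1, rfl⟩

theorem restrict_summable (M : ℕ) (δ : ℝ) (g : ℤ → ℂ) (F : ℤ → ℂ → ℂ) (hF : ∀ l, F l 0 = 0) :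
    Summable fun l : ℤ => F l (restrictA (alphabetA M δ) g l) := by
  apply summable_of_ne_finset_zero (s := (Finset.range M).map Nat.castEmbedding)
  · intro l hl
    unfold restrictA
    rw [if_neg, hF]
    rintro ⟨a, ha, rfl⟩
    apply hl
    unfold alphabetA at ha
    rw [Finset.mem_map]
    exact ⟨a, (Finset.mem_filter.1 ha).1, rfl⟩

/-- pointwise bound off the alphabet -/
theorem off_bound (M : ℕ) (hM : 4 ≤ M) (δ : ℝ) (hδ1 : 1 / 2 < δ) (hδ2 : δ < 1) (a : ℕ) (haM : a < M)
    (ha : a ∉ alphabetA M δ) (y : ℝ) (hy : y ∈ Set.Icc 0 (1 / (M : ℝ))) :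
    ‖∑' l : ℤ, restrictA (alphabetA M δ) (gaussD M) l * ec ((l : ℝ) * ((a : ℝ) / M + y))‖ ≤
      ((∑' j : ℤ, Real.exp (-Real.pi * ((j : ℝ) ^ 2 - |(j : ℝ)|))) * Real.exp Real.pi +
        16 * (∑' l : ℤ, 1 / (1 + (l : ℝ) ^ 2))) * M *
        Real.exp (-(3 / 16 * Real.pi * (M : ℝ) ^ (2 * δ - 1))) := by
  have hM1 : 1 ≤ M := by omega
  have hMr : (4 : ℝ) ≤ M := by exact_mod_cast hM
  have hM0 : (0 : ℝ) < M := by linarith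
  set x := (a : ℝ) / M + y with hx
  have hMx : M * x = a + M * y := by rw [hx]; field_simp
  have hy0 : 0 ≤ M * y := mul_nonneg hM0.le hy.1
  have hy1 : M * y ≤ 1 := by
    have := hy.2
    rw [le_div_iff₀ hM0] at this; linarith
  have haM' : (a : ℝ) + 1 ≤ M := by exact_mod_cast haM
  have ha0 : (0 : ℝ) ≤ a := Nat.cast_nonneg a
  have hx0 : 0 ≤ x := by have := hy.1; positivity
  have hx1 : x ≤ 1 := by
    by_contra hc; push Not at hc; nlinarith
  have h1 := theta_bound M hM1 x hx0 hx1
  have h2 := tail_bound M hM1 δ hδ2 x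
  rw [(summ_gauss M hM1 x).tsum_sub (restrict_summable M δ (gaussD M) (fun l z => z * ec ((l : ℝ) * x)) (by simp))] at h2
  have h3 := norm_sub_norm_le (∑' l : ℤ, restrictA (alphabetA M δ) (gaussD M) l * ec ((l : ℝ) * x)) (∑' l : ℤ, gaussD M l * ec ((l : ℝ) * x))
  rw [norm_sub_rev] at h3
  set T := ∑' j : ℤ, Real.exp (-Real.pi * ((j : ℝ) ^ 2 - |(j : ℝ)|))
  have hT : 0 ≤ T := tsum_nonneg fun _ => (Real.exp_pos _).le
  have hn := not_mem M hM1 δ hδ2 a (by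
    rintro ⟨b, hb, hab⟩
    have : a = b := by exact_mod_cast hab
    exact ha (this ▸ hb))
  push_cast at hn
  set K := (M : ℝ) ^ δ with hK
  have hK2 : 2 ≤ K := by
    have : (4 : ℝ) ^ (1 / 2 : ℝ) = 2 := by
      rw [← Real.sqrt_eq_rpow]
      rw [show (4 : ℝ) = 2 ^ 2 by norm_num]; exact Real.sqrt_sq (by norm_num)
    rw [← this]
    calc (4 : ℝ) ^ (1 / 2 : ℝ) ≤ (M : ℝ) ^ (1 / 2 : ℝ) := by gcongr
      _ ≤ _ := Real.rpow_le_rpow_of_exponent_le (by linarith) hδ1.le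
  have hKM : K ≤ M := by
    conv_rhs => rw [← Real.rpow_one (M : ℝ)]
    exact Real.rpow_le_rpow_of_exponent_le (by linarith) hδ2.le
  have h4 : M * (x - 1 / 2) ^ 2 = (a + M * y - M / 2) ^ 2 / M := by
    rw [← hMx]; field_simp
  have h5 : K / 2 - 1 ≤ |a + M * y - M / 2| := by
    rcases abs_cases ((a : ℝ) - M / 2) with ⟨h, h'⟩ | ⟨h, h'⟩ <;> rw [h] at hn
    · exact le_trans (by linarith) (le_abs_self _)
    · exact le_trans (by linarith) (neg_le_abs _)
  have h6 : (K / 2 - 1) ^ 2 ≤ (a + M * y - M / 2) ^ 2 := by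
    rw [← sq_abs (_ - (M : ℝ) / 2)]
    have : 0 ≤ K / 2 - 1 := by linarith
    gcongr
  have h7 : K ^ 2 / M / 4 - 1 ≤ M * (x - 1 / 2) ^ 2 := by
    rw [h4, le_div_iff₀ hM0]
    have : (K ^ 2 / M / 4 - 1) * M = K ^ 2 / 4 - M := by field_simp
    rw [this]; nlinarith
  have h8 : Real.exp (-Real.pi * (M * (x - 1 / 2) ^ 2)) ≤
      Real.exp Real.pi * Real.exp (-(3 / 16 * Real.pi * (M : ℝ) ^ (2 * δ - 1))) := by
    rw [← Real.exp_add, rpow_id M hM1 δ]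
    gcongr
    have : 0 ≤ Real.pi * (K ^ 2 / M) := by positivity
    nlinarith [Real.pi_pos]
  set e := Real.exp (-(3 / 16 * Real.pi * (M : ℝ) ^ (2 * δ - 1)))
  have h9 : T * Real.exp (-Real.pi * (M * (x - 1 / 2) ^ 2)) ≤ T * (Real.exp Real.pi * e) := by gcongr
  have h10 : T * (Real.exp Real.pi * e) * 1 ≤ T * (Real.exp Real.pi * e) * M := by gcongr; linarith
  nlinarith

theorem norm_lower (M : ℕ) (hM : 4 ≤ M) (δ : ℝ) (hδ1 : 1 / 2 < δ) :
    Real.exp (-Real.pi) / M ≤ ∑ l ∈ Finset.range M, ‖restrictA (alphabetA M δ) (gaussD M) l‖ ^ 2 := by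
  have hMr : (4 : ℝ) ≤ M := by exact_mod_cast hM
  have hlt : M / 2 < M := by omega
  have h1 : |((M / 2 : ℕ) : ℝ) - M / 2| ≤ 1 / 2 := by
    rcases Nat.even_or_odd' M with ⟨m, h | h⟩
    · have h1 : M / 2 = m := by omega
      rw [h1, h]; push_cast; norm_num
    · have h1 : M / 2 = m := by omega
      rw [h1, h]; push_cast
      rw [abs_le]; constructor <;> linarith
  have hK : 1 ≤ (M : ℝ) ^ δ := Real.one_le_rpow (by linarith) (by linarith)
  have hmem : M / 2 ∈ alphabetA M δ := by
    unfold alphabetA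
    rw [Finset.mem_filter, Finset.mem_range]
    exact ⟨hlt, h1.trans (by linarith)⟩
  refine le_trans ?_ (Finset.single_le_sum (f := fun l : ℕ => ‖restrictA (alphabetA M δ) (gaussD M) l‖ ^ 2) (fun _ _ => sq_nonneg _) (Finset.mem_range.2 hlt))
  have : restrictA (alphabetA M δ) (gaussD M) ((M / 2 : ℕ) : ℤ) = gaussD M ((M / 2 : ℕ) : ℤ) := by
    unfold restrictA; rw [if_pos ⟨_, hmem, rfl⟩]
  simp only [this]
  rw [gauss_norm, mul_pow, inv_pow, Real.sq_sqrt (by linarith), ← Real.exp_nat_mul, ← div_eq_inv_mul]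
  gcongr
  rw [Int.cast_natCast]
  have h2 : (((M / 2 : ℕ) : ℝ) - M / 2) ^ 2 ≤ 1 / 4 := by
    rw [← sq_abs]; nlinarith [abs_nonneg (((M / 2 : ℕ) : ℝ) - M / 2)]
  have h3 : Real.pi * (((M / 2 : ℕ) : ℝ) - M / 2) ^ 2 / M ≤ Real.pi / 2 := by
    rw [div_le_iff₀ (by linarith)]
    nlinarith [Real.pi_pos]
  push_cast at h3 ⊢
  linarith

theorem final_ineq (δ : ℝ) (hδ1 : 1 / 2 < δ) (C : ℝ) : ∃ M₀ : ℕ, ∀ M : ℕ, M₀ ≤ M →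
    C * M ^ 3 * Real.exp (-(3 / 16 * Real.pi * (M : ℝ) ^ (2 * δ - 1))) ^ 2 ≤
      1 - Real.exp (-(340 * Real.exp (-(Real.pi / 4) * (M : ℝ) ^ (2 * δ - 1)))) := by
  have hp : 0 < 2 * δ - 1 := by linarith
  have hpow : Filter.Tendsto (fun M : ℕ => (M : ℝ) ^ (2 * δ - 1)) Filter.atTop Filter.atTop :=
    (tendsto_rpow_atTop hp).comp tendsto_natCast_atTop_atTop
  have h1 := (tendsto_rpow_mul_exp_neg_mul_atTop_nhds_zero (3 / (2 * δ - 1)) (Real.pi / 8) (by have := Real.pi_pos; positivity)).comp hpow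
  have h1' := h1.const_mul C
  have h2 := (tendsto_rpow_mul_exp_neg_mul_atTop_nhds_zero 0 (Real.pi / 4) (by have := Real.pi_pos; positivity)).comp hpow
  rw [mul_zero] at h1'
  have e1 := h1'.eventually (gt_mem_nhds (show (0 : ℝ) < 170 by norm_num))
  have e2 := h2.eventually (gt_mem_nhds (show (0 : ℝ) < 1 / 340 by norm_num))
  obtain ⟨M₀, hM₀⟩ := Filter.eventually_atTop.1 (e1.and e2)
  refine ⟨M₀, fun M hM => ?_⟩
  obtain ⟨f1, f2⟩ := hM₀ M hM
  simp only [Function.comp, Real.rpow_zero, one_mul] at f1 f2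
  rw [← Real.rpow_mul (Nat.cast_nonneg M), mul_div_cancel₀ _ hp.ne'] at f1
  set P := (M : ℝ) ^ (2 * δ - 1)
  have g1 : (M : ℝ) ^ (3 : ℝ) = (M : ℝ) ^ 3 := by norm_cast
  rw [g1] at f1
  have g2 : Real.exp (-(3 / 16 * Real.pi * P)) ^ 2 = Real.exp (-(Real.pi / 8) * P) * Real.exp (-(Real.pi / 4) * P) := by
    rw [← Real.exp_nat_mul, ← Real.exp_add]; congr 1; push_cast; ring
  rw [g2]
  set E := Real.exp (-(Real.pi / 4) * P)
  have hE : 0 < E := Real.exp_pos _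
  have g3 : Real.exp (-(340 * E)) ≤ 1 - 170 * E := by
    rw [Real.exp_neg, inv_le_iff_one_le_mul₀ (Real.exp_pos _)]
    have := Real.add_one_le_exp (340 * E)
    have h0 : 0 ≤ 1 - 170 * E := by linarith
    calc 1 ≤ (1 - 170 * E) * (340 * E + 1) := by nlinarith
      _ ≤ _ := by gcongr
  have g4 : C * M ^ 3 * (Real.exp (-(Real.pi / 8) * P) * E) ≤ 170 * E := by
    have := mul_le_mul_of_nonneg_right f1.le hE.le
    linarith
  linarith

/-- `Z_A(f/‖f‖) ≥ exp(-340 e^{-(π/4) M^{2δ-1}})` for `f = g·𝟙_A`. -/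
theorem stmt12 (δ : ℝ) (hδ1 : 1 / 2 < δ) (hδ2 : δ < 1) :
    ∃ M₀ : ℕ, ∀ M : ℕ, M₀ ≤ M →
      Real.exp (-(340 * Real.exp (-(Real.pi / 4) * (M : ℝ) ^ (2 * δ - 1)))) ≤
        ZA M (alphabetA M δ) (fun l => restrictA (alphabetA M δ) (gaussD M) l /
          ((Real.sqrt (∑' l' : ℤ,
            ‖restrictA (alphabetA M δ) (gaussD M) l'‖ ^ 2) : ℝ) : ℂ)) := by
  set D := ((∑' j : ℤ, Real.exp (-Real.pi * ((j : ℝ) ^ 2 - |(j : ℝ)|))) * Real.exp Real.pi +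
        16 * (∑' l : ℤ, 1 / (1 + (l : ℝ) ^ 2))) with hD
  obtain ⟨M₀, hM₀⟩ := final_ineq δ hδ1 (D ^ 2 * Real.exp Real.pi)
  refine ⟨max M₀ 4, fun M hM => ?_⟩
  have hM4 : 4 ≤ M := (le_max_right _ _).trans hM
  have hfin := hM₀ M ((le_max_left _ _).trans hM)
  have hMr : (4 : ℝ) ≤ M := by exact_mod_cast hM4
  have hM0 : (0 : ℝ) < M := by linarith
  have hS := restrict_tsum M δ (gaussD M) (fun _ z => ‖z‖ ^ 2) (by simp)
  rw [hS]
  set S := ∑ l ∈ Finset.range M, ‖restrictA (alphabetA M δ) (gaussD M) l‖ ^ 2 with hSdef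
  have hSlow : Real.exp (-Real.pi) / M ≤ S := norm_lower M hM4 δ hδ1
  have hS0 : 0 < S := lt_of_lt_of_le (by positivity) hSlow
  unfold ZA
  apply le_csInf
  · exact (Set.nonempty_Icc.2 (by positivity)).image _
  rintro _ ⟨y, hy, rfl⟩
  simp only
  have hG : ∀ x : ℝ, ‖Gf M (fun l => restrictA (alphabetA M δ) (gaussD M) l / ((Real.sqrt S : ℝ) : ℂ)) x‖ ^ 2
      = ‖∑' l : ℤ, restrictA (alphabetA M δ) (gaussD M) l * ec ((l : ℝ) * x)‖ ^ 2 / (M * S) := by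
    intro x
    unfold Gf
    simp_rw [div_mul_eq_mul_div]
    rw [tsum_div_const, norm_mul, norm_div, Complex.norm_real, Complex.norm_real,
      Real.norm_of_nonneg (by positivity), Real.norm_of_nonneg (by positivity), mul_pow, div_pow,
      inv_pow, Real.sq_sqrt hM0.le, Real.sq_sqrt hS0.le,
      ← div_eq_inv_mul, div_div, mul_comm S]
  simp_rw [hG]
  rw [← Finset.sum_div]
  have hpars := parseval M (by omega) (fun l => restrictA (alphabetA M δ) (gaussD M) l) y
  have hR : ∀ a : ℕ, ∑ l ∈ Finset.range M, restrictA (alphabetA M δ) (gaussD M) l * ec ((l : ℝ) * ((a : ℝ) / M + y)) = ∑' l : ℤ, restrictA (alphabetA M δ) (gaussD M) l * ec ((l : ℝ) * ((a : ℝ) / M + y)) := by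
    intro a
    rw [restrict_tsum M δ (gaussD M) (fun l z => z * ec ((l : ℝ) * ((a : ℝ) / M + y))) (by simp)]
    simp
  simp only [hR] at hpars
  have hsub : alphabetA M δ ⊆ Finset.range M := Finset.filter_subset _ _
  rw [← Finset.sum_sdiff hsub, ← hSdef] at hpars
  set e := Real.exp (-(3 / 16 * Real.pi * (M : ℝ) ^ (2 * δ - 1))) with he
  have hoff : ∑ a ∈ Finset.range M \ alphabetA M δ, ‖∑' l : ℤ, restrictA (alphabetA M δ) (gaussD M) l * ec ((l : ℝ) * ((a : ℝ) / M + y))‖ ^ 2 ≤ M * (D * M * e) ^ 2 := by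
    calc _ ≤ ∑ a ∈ Finset.range M \ alphabetA M δ, (D * M * e) ^ 2 := by
          refine Finset.sum_le_sum fun a ha => ?_
          rw [Finset.mem_sdiff, Finset.mem_range] at ha
          have := off_bound M hM4 δ hδ1 hδ2 a ha.1 ha.2 y hy
          gcongr
      _ ≤ _ := by
          rw [Finset.sum_const, nsmul_eq_mul]
          gcongr
          calc _ ≤ (Finset.range M).card := Finset.card_le_card Finset.sdiff_subset
            _ = M := Finset.card_range M
  rw [le_div_iff₀ (by positivity)]
  have h1 : M * (D * M * e) ^ 2 ≤ (D ^ 2 * Real.exp Real.pi * M ^ 3 * e ^ 2) * (M * S) := by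
    have h2 : 1 ≤ Real.exp Real.pi * (M * S) := by
      rw [div_le_iff₀ hM0] at hSlow
      have h3 : Real.exp Real.pi * Real.exp (-Real.pi) ≤ Real.exp Real.pi * (S * M) := by gcongr
      rw [← Real.exp_add] at h3
      simp at h3
      linarith
    calc M * (D * M * e) ^ 2 = (M * (D * M * e) ^ 2) * 1 := by ring
      _ ≤ (M * (D * M * e) ^ 2) * (Real.exp Real.pi * (M * S)) := by gcongr
      _ = _ := by ring
  have h4 := mul_le_mul_of_nonneg_right hfin (show 0 ≤ M * S by positivity)
  linarith

end
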